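/- arXiv:1806.08988 — 3 statements merged into one kernel-verified Lean document; each statement's English description precedes it below -/
import Mathlib

section
/- Let (𝕋_n)_{n∈ℕ} be a balanced sequence of partitions of [r,T], F : [r,T] × C([0,T],ℝ^m) → ℝ^m be d_∞-Lipschitz continuous, and (ₙY)_{n∈ℕ} be a sequence of adapted continuous processes for which there are c₀, c_{2,0} ≥ 0 such that |F(t,x)| ≤ c₀(1 + ‖x‖_∞) and E[‖ₙY‖_∞²] + E[‖ₙY^s − ₙY^t‖_∞²]/|s−t| ≤ c_{2,0}(1 + E[‖ₙY^r‖_∞²]) for all n ∈ ℕ, s,t ∈ [r,T] with s ≠ t, and x ∈ C([0,T],ℝ^m). Then there is c₂ > 0 such that for each n ∈ ℕ, E[ max_{j∈{0,…,k_n}} | ∫_r^{t_{j,n}} F(\underline{s}_n, ₙY)·(γ_n(s) − 1) ds |² ] ≤ c₂ · |𝕋_n| · (1 + E[‖ₙY^r‖_∞²]), where γ_n(s) := Δs_n/Δ\overline{s}_n, i.e. γ_n = 0 on [r,t_{1,n}), γ_n = (t_{i,n}−t_{i−1,n})/(t_{i+1,n}−t_{i,n}) on [t_{i,n},t_{i+1,n})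 for 1 ≤ i ≤ k_n−1, and γ_n(T) = 1. -/
open MeasureTheory Set Filter ENNReal

noncomputable section

variable {E F' : Type*} [NormedAddCommGroup E] [NormedAddCommGroup F']

/-- Supremum of `‖x‖` over the interval `[a,b]` (real-valued). -/
def supIcc (a b : ℝ) (x : ℝ → E) : ℝ :=
  sSup ((fun u => ‖x u‖) '' Set.Icc a b)

/-- Supremum (in `[0,∞]`) of `‖x‖` over the interval `[a,b]`. -/
def eSupIcc (a b : ℝ) (x : ℝ → E) : ℝ≥0∞ :=
  ⨆ t : Set.Icc a b, (‖x (t : ℝ)‖₊ : ℝ≥0∞)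

/-- Mesh of the `n`-th partition `r = t_{0,n} < ⋯ < t_{k_n,n} = T`. -/
def pmesh (k : ℕ → ℕ) (t : ℕ → ℕ → ℝ) (n : ℕ) : ℝ :=
  sSup ((fun i => t n (i + 1) - t n i) '' Set.Iio (k n))

/-- A non-anticipative functional is `d_∞`-Lipschitz continuous if
`‖F(t,x) − F(s,y)‖ ≤ λ (|t−s|^{1/2} + ‖x^t − y^s‖_∞)`. -/
def DInftyLipschitz (r T : ℝ) (G : ℝ → (ℝ → E) → F') : Prop :=
  ∃ lam ≥ (0:ℝ), ∀ s ∈ Set.Icc r T, ∀ t ∈ Set.Icc r T, ∀ x y : ℝ → E,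
    ContinuousOn x (Set.Icc 0 T) → ContinuousOn y (Set.Icc 0 T) →
    ‖G t x - G s y‖ ≤
      lam * (|t - s| ^ ((1:ℝ)/2) + supIcc 0 T (fun u => x (min u t) - y (min u s)))

end

lemma rr_ofReal_supIcc_le {E : Type*} [NormedAddCommGroup E] {T : ℝ} (hT : 0 ≤ T) (x : ℝ → E)
    (hx : ContinuousOn x (Set.Icc 0 T)) : ENNReal.ofReal (supIcc 0 T x) ≤ eSupIcc 0 T x := by
  obtain ⟨u, hu, hmax⟩ := isCompact_Icc.exists_sSup_image_eq (Set.nonempty_Icc.2 hT) hx.norm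
  unfold supIcc eSupIcc
  rw [hmax]
  refine le_trans ?_ (le_iSup (fun t : Set.Icc (0:ℝ) T => (‖x (t : ℝ)‖₊ : ℝ≥0∞)) ⟨u, hu⟩)
  rw [ofReal_norm_eq_enorm]; rfl

lemma rr_supIcc_nonneg {E : Type*} [NormedAddCommGroup E] (a b : ℝ) (x : ℝ → E) :
    0 ≤ supIcc a b x := by
  apply Real.sSup_nonneg
  rintro _ ⟨u, _, rfl⟩
  exact norm_nonneg _

lemma rr_measurable_eSup {Ω E : Type*} {mΩ : MeasurableSpace Ω} [NormedAddCommGroup E]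
    [MeasurableSpace E] [BorelSpace E] (T : ℝ)
    (Z : ℝ → Ω → E) (hZ : ∀ v, Measurable (Z v))
    (hc : ∀ ω, ContinuousOn (fun v => Z v ω) (Set.Icc 0 T)) :
    Measurable (fun ω => eSupIcc 0 T (fun v => Z v ω)) := by
  obtain ⟨D, hDc, hDd⟩ := TopologicalSpace.exists_countable_dense (Set.Icc (0:ℝ) T)
  have key : (fun ω => eSupIcc 0 T (fun v => Z v ω)) =
      fun ω => ⨆ d ∈ D, (‖Z (d : ℝ) ω‖₊ : ℝ≥0∞) := by
    funext ω
    apply le_antisymm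
    · unfold eSupIcc
      apply iSup_le
      have hcl : IsClosed {v : Set.Icc (0:ℝ) T | (‖Z (v : ℝ) ω‖₊ : ℝ≥0∞) ≤
          ⨆ d ∈ D, (‖Z (d : ℝ) ω‖₊ : ℝ≥0∞)} := by
        apply isClosed_le _ continuous_const
        exact ENNReal.continuous_coe.comp (continuous_nnnorm.comp (hc ω).restrict)
      have hsub : D ⊆ {v : Set.Icc (0:ℝ) T | (‖Z (v : ℝ) ω‖₊ : ℝ≥0∞) ≤
          ⨆ d ∈ D, (‖Z (d : ℝ) ω‖₊ : ℝ≥0∞)} := fun d hd =>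
        le_iSup₂ (f := fun (d : Set.Icc (0:ℝ) T) (_ : d ∈ D) => (‖Z (d : ℝ) ω‖₊ : ℝ≥0∞)) d hd
      intro v
      exact hcl.closure_subset_iff.2 hsub (hDd v)
    · apply iSup₂_le
      intro d _
      exact le_iSup (fun t : Set.Icc (0:ℝ) T => (‖Z (t : ℝ) ω‖₊ : ℝ≥0∞)) d
  rw [key]
  exact Measurable.biSup D hDc (fun d _ => (hZ d).nnnorm.coe_nnreal_ennreal)

lemma rr_integral_formula {E : Type*} [NormedAddCommGroup E] [NormedSpace ℝ E] [CompleteSpace E]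
    (t : ℕ → ℝ) (k : ℕ) (hmono : ∀ i < k, t i < t (i + 1)) (g : ℝ → E) (f : ℕ → E)
    (h0 : ∀ s ∈ Set.Ico (t 0) (t 1), g s = - f 0)
    (h1 : ∀ i, i + 1 < k → ∀ s ∈ Set.Ico (t (i + 1)) (t (i + 2)),
      g s = ((t (i + 1) - t i) / (t (i + 2) - t (i + 1)) - 1) • f i) :
    ∀ j < k, t 0 < t (j + 1) ∧ IntegrableOn g (Set.Ico (t 0) (t (j + 1))) ∧
      ∫ s in Set.Ico (t 0) (t (j + 1)), g s =
        ∑ i ∈ Finset.range j, (t (i + 1) - t i) • (f i - f (i - 1))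
          - (t (j + 1) - t j) • f (j - 1) := by
  intro j
  induction j with
  | zero =>
    intro hj
    have hlt := hmono 0 hj
    refine ⟨hlt, ?_, ?_⟩
    · rw [integrableOn_congr_fun h0 measurableSet_Ico]
      exact integrableOn_const (by simp)
    · rw [setIntegral_congr_fun measurableSet_Ico h0, setIntegral_const]
      simp [hlt.le, measureReal_def]
  | succ j ih =>
    intro hj
    obtain ⟨hlt, hint, heq⟩ := ih (by omega)
    have hlt2 := hmono (j + 1) hj
    have hint2 : IntegrableOn g (Set.Ico (t (j + 1)) (t (j + 2))) := by
      rw [integrableOn_congr_fun (h1 j hj) measurableSet_Ico]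
      exact integrableOn_const (by simp)
    have hu : Set.Ico (t 0) (t (j + 1 + 1)) =
        Set.Ico (t 0) (t (j + 1)) ∪ Set.Ico (t (j + 1)) (t (j + 2)) :=
      (Set.Ico_union_Ico_eq_Ico hlt.le hlt2.le).symm
    have hd : Disjoint (Set.Ico (t 0) (t (j + 1))) (Set.Ico (t (j + 1)) (t (j + 2))) := by
      rw [Set.Ico_disjoint_Ico]; simp [hlt2.le]
    refine ⟨hlt.trans hlt2, ?_, ?_⟩
    · rw [hu]; exact hint.union hint2
    · rw [hu, setIntegral_union hd measurableSet_Ico hint hint2, heq,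
        setIntegral_congr_fun measurableSet_Ico (h1 j hj), setIntegral_const,
        Finset.sum_range_succ]
      have hne : t (j + 2) - t (j + 1) ≠ 0 := by
        have : t (j + 1) < t (j + 2) := hlt2
        linarith
      have hr : volume.real (Set.Ico (t (j + 1)) (t (j + 2))) = t (j + 2) - t (j + 1) := by
        have : t (j + 1) < t (j + 2) := hlt2
        rw [Real.volume_real_Ico_of_le this.le]
      rw [hr, smul_smul]
      have : (t (j + 2) - t (j + 1)) * ((t (j + 1) - t j) / (t (j + 2) - t (j + 1)) - 1) =
          (t (j + 1) - t j) - (t (j + 2) - t (j + 1)) := by field_simp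
      rw [this]
      simp only [Nat.add_sub_cancel, smul_sub, sub_smul, add_assoc, Nat.reduceAdd]
      abel

lemma rr_norm_sq {E : Type*} [NormedAddCommGroup E] [NormedSpace ℝ E]
    (t : ℕ → ℝ) (k : ℕ) (hmono : ∀ i < k, t i < t (i + 1)) (f : ℕ → E) (M B : ℝ)
    (hM : ∀ i < k, t (i + 1) - t i ≤ M) (hM0 : 0 ≤ M)
    (lam : ℝ) (d : ℕ → ℝ)
    (hB : ∀ i < k, ‖f i‖ ≤ B) 
    (hd : ∀ i < k, ‖f i - f (i - 1)‖ ≤ lam * (M ^ ((1:ℝ)/2) + d i)) (j : ℕ) (hj : j < k) :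
    ‖∑ i ∈ Finset.range j, (t (i + 1) - t i) • (f i - f (i - 1))
          - (t (j + 1) - t j) • f (j - 1)‖ ^ 2 ≤
      4 * lam ^ 2 * (t k - t 0) * ((t k - t 0) * M +
        ∑ i ∈ Finset.range k, (t (i + 1) - t i) * d i ^ 2) + 2 * M ^ 2 * B ^ 2 := by
  have hpos : ∀ i ∈ Finset.range k, 0 ≤ t (i + 1) - t i := fun i hi => by
    have := hmono i (Finset.mem_range.1 hi); linarith
  have hsum : ∑ i ∈ Finset.range k, (t (i + 1) - t i) = t k - t 0 :=
    Finset.sum_range_sub t k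
  have hB0 : 0 ≤ B := (norm_nonneg _).trans (hB j hj)
  set A := ∑ i ∈ Finset.range k, (t (i + 1) - t i) * ‖f i - f (i - 1)‖ with hA
  have hn : ‖∑ i ∈ Finset.range j, (t (i + 1) - t i) • (f i - f (i - 1))
          - (t (j + 1) - t j) • f (j - 1)‖ ≤ A + M * B := by
    refine (norm_sub_le _ _).trans (add_le_add ?_ ?_)
    · refine (norm_sum_le _ _).trans ?_
      calc _ = ∑ i ∈ Finset.range j, (t (i + 1) - t i) * ‖f i - f (i - 1)‖ := by
            refine Finset.sum_congr rfl fun i hi => ?_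
            rw [norm_smul, Real.norm_of_nonneg (hpos i ?_)]
            simp at hi ⊢; omega
        _ ≤ A := Finset.sum_le_sum_of_subset_of_nonneg
            (Finset.range_mono hj.le)
            (fun i hi _ => mul_nonneg (hpos i hi) (norm_nonneg _))
    · rw [norm_smul, Real.norm_of_nonneg (hpos j (by simpa using hj))]
      exact mul_le_mul (hM j hj) (hB _ (by omega)) (norm_nonneg _) hM0
  have hCS : A ^ 2 ≤ (t k - t 0) *
      ∑ i ∈ Finset.range k, (t (i + 1) - t i) * ‖f i - f (i - 1)‖ ^ 2 := by
    rw [← hsum]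
    apply Finset.sum_sq_le_sum_mul_sum_of_sq_le_mul
    · exact hpos
    · exact fun i hi => mul_nonneg (hpos i hi) (sq_nonneg _)
    · intro i _; exact le_of_eq (by ring)
  have hsq : (M ^ ((1:ℝ)/2)) ^ 2 = M := by
    rw [← Real.sqrt_eq_rpow, Real.sq_sqrt hM0]
  have hS : ∑ i ∈ Finset.range k, (t (i + 1) - t i) * ‖f i - f (i - 1)‖ ^ 2 ≤
      2 * lam ^ 2 * ((t k - t 0) * M +
        ∑ i ∈ Finset.range k, (t (i + 1) - t i) * d i ^ 2) := by
    rw [← hsum, Finset.sum_mul, ← Finset.sum_add_distrib, Finset.mul_sum]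
    refine Finset.sum_le_sum fun i hi => ?_
    have h1 := hd i (Finset.mem_range.1 hi)
    have h2 : ‖f i - f (i - 1)‖ ^ 2 ≤ 2 * lam ^ 2 * (M + d i ^ 2) := by
      calc ‖f i - f (i - 1)‖ ^ 2 ≤ (lam * (M ^ ((1:ℝ)/2) + d i)) ^ 2 :=
            pow_le_pow_left₀ (norm_nonneg _) h1 2
        _ = lam ^ 2 * (M ^ ((1:ℝ)/2) + d i) ^ 2 := by ring
        _ ≤ lam ^ 2 * (2 * ((M ^ ((1:ℝ)/2)) ^ 2 + d i ^ 2)) :=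
            mul_le_mul_of_nonneg_left add_sq_le (sq_nonneg _)
        _ = _ := by rw [hsq]; ring
    calc _ ≤ (t (i + 1) - t i) * (2 * lam ^ 2 * (M + d i ^ 2)) :=
          mul_le_mul_of_nonneg_left h2 (hpos i hi)
      _ = _ := by ring
  have htk : 0 ≤ t k - t 0 := hsum ▸ Finset.sum_nonneg hpos
  calc _ ≤ (A + M * B) ^ 2 := pow_le_pow_left₀ (norm_nonneg _) hn 2
    _ ≤ 2 * (A ^ 2 + (M * B) ^ 2) := add_sq_le
    _ ≤ 2 * ((t k - t 0) * (2 * lam ^ 2 * ((t k - t 0) * M +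
        ∑ i ∈ Finset.range k, (t (i + 1) - t i) * d i ^ 2)) + (M * B) ^ 2) := by
        have := hCS.trans (mul_le_mul_of_nonneg_left hS htk)
        linarith
    _ = _ := by ring

/-- **Riemann-sum remainder estimate** (Lemma 3.9 / Statement 11): for a `d_∞`-Lipschitz
functional `F` of affine growth and a sequence of adapted continuous processes `ₙY` with
uniform second-moment and increment bounds,
`E[max_j |∫_r^{t_{j,n}} F(\underline{s}_n, ₙY)(γ_n(s) − 1) ds|²] ≤ c₂ |𝕋_n| (1 + E[‖ₙY^r‖_∞²])`. -/
theorem riemann_remainder_estimate {m : ℕ} (r T : ℝ) (hr : 0 ≤ r) (hrT : r < T)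
    {Ω : Type*} {mΩ : MeasurableSpace Ω} (P : Measure Ω) [IsProbabilityMeasure P]
    (F : Filtration ℝ mΩ)
    (k : ℕ → ℕ) (t : ℕ → ℕ → ℝ)
    (hk : ∀ n, 0 < k n) (ht0 : ∀ n, t n 0 = r) (htlast : ∀ n, t n (k n) = T)
    (hmono : ∀ n, ∀ i < k n, t n i < t n (i + 1))
    (hmesh : Filter.Tendsto (pmesh k t) Filter.atTop (nhds 0))
    (cT : ℝ) (hcT : 1 ≤ cT)
    (hbal : ∀ n, ∀ i < k n, pmesh k t n ≤ cT * (t n (i + 1) - t n i))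
    (G : ℝ → (ℝ → EuclideanSpace ℝ (Fin m)) → EuclideanSpace ℝ (Fin m))
    (hGlip : DInftyLipschitz r T G)
    (c₀ : ℝ) (hc₀ : 0 ≤ c₀)
    (hGgrowth : ∀ s ∈ Set.Icc r T, ∀ x : ℝ → EuclideanSpace ℝ (Fin m),
      ContinuousOn x (Set.Icc 0 T) → ‖G s x‖ ≤ c₀ * (1 + supIcc 0 T x))
    (Y : ℕ → ℝ → Ω → EuclideanSpace ℝ (Fin m))
    (hadapt : ∀ n, Adapted F (Y n))
    (hcont : ∀ n ω, ContinuousOn (fun s => Y n s ω) (Set.Icc 0 T))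
    (c20 : ℝ) (hc20 : 0 ≤ c20)
    (hmom : ∀ n, ∀ s ∈ Set.Icc r T, ∀ u ∈ Set.Icc r T, s ≠ u →
      (∫⁻ ω, eSupIcc 0 T (fun v => Y n v ω) ^ 2 ∂P) +
        (∫⁻ ω, eSupIcc 0 T (fun v => Y n (min v s) ω - Y n (min v u) ω) ^ 2 ∂P) /
          ENNReal.ofReal |s - u|
      ≤ ENNReal.ofReal c20 *
          (1 + ∫⁻ ω, eSupIcc 0 T (fun v => Y n (min v r) ω) ^ 2 ∂P))
    (flo : ℕ → ℝ → ℝ)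
    (hflo : ∀ n, (∀ i < k n, ∀ s ∈ Set.Ico (t n i) (t n (i + 1)), flo n s = t n (i - 1)) ∧
      flo n T = t n (k n - 1))
    (gam : ℕ → ℝ → ℝ)
    (hgam : ∀ n, (∀ s ∈ Set.Ico r (t n 1), gam n s = 0) ∧
      (∀ i, 1 ≤ i → i < k n → ∀ s ∈ Set.Ico (t n i) (t n (i + 1)),
        gam n s = (t n i - t n (i - 1)) / (t n (i + 1) - t n i)) ∧
      gam n T = 1) :
    ∃ c₂ > (0:ℝ), ∀ n,
      ∫⁻ ω, (⨆ j, ⨆ _ : j ≤ k n,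
          (‖∫ s in Set.Icc r (t n j),
              (gam n s - 1) • G (flo n s) (fun u => Y n u ω)‖₊ : ℝ≥0∞)) ^ 2 ∂P
        ≤ ENNReal.ofReal (c₂ * pmesh k t n) *
            (1 + ∫⁻ ω, eSupIcc 0 T (fun v => Y n (min v r) ω) ^ 2 ∂P) := by
  obtain ⟨lam, hlam, hlip⟩ := hGlip
  have hT0 : 0 ≤ T := hr.trans hrT.le
  have hL : 0 < T - r := by linarith
  refine ⟨(4 * lam ^ 2 * (T - r) ^ 2 + 4 * c₀ ^ 2 * (T - r)) +
    4 * lam ^ 2 * (T - r) * ((T - r) * c20) + 4 * c₀ ^ 2 * (T - r) * c20 + 1, by positivity, ?_⟩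
  intro n
  set M := pmesh k t n with hMdef
  set W := 1 + ∫⁻ ω, eSupIcc 0 T (fun v => Y n (min v r) ω) ^ 2 ∂P with hW
  have hW1 : 1 ≤ W := le_self_add
  have htm : ∀ i j, i ≤ j → j ≤ k n → t n i ≤ t n j := by
    intro i j hij
    induction j, hij using Nat.le_induction with
    | base => intro _; exact le_rfl
    | succ j hij ih => intro hj; exact (ih (by omega)).trans (hmono n j (by omega)).le
  have htI : ∀ i ≤ k n, t n i ∈ Set.Icc r T := fun i hi =>
    ⟨ht0 n ▸ htm 0 i (Nat.zero_le _) hi, htlast n ▸ htm i (k n) hi le_rfl⟩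
  have hδM : ∀ i < k n, t n (i + 1) - t n i ≤ M := fun i hi =>
    le_csSup (((Set.finite_Iio (k n)).image _).bddAbove) ⟨i, hi, rfl⟩
  have hδ0 : ∀ i < k n, 0 < t n (i + 1) - t n i := fun i hi => sub_pos.2 (hmono n i hi)
  have hM0 : 0 < M := (hδ0 0 (hk n)).trans_le (hδM 0 (hk n))
  have hML : M ≤ T - r := by
    apply csSup_le
    · exact ⟨_, 0, hk n, rfl⟩
    · rintro _ ⟨i, hi, rfl⟩
      have hi' : i < k n := hi
      have h1 := (htI (i + 1) hi').2
      have h2 := (htI i hi'.le).1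
      show t n (i + 1) - t n i ≤ T - r
      linarith
  have hmeasY : ∀ v, Measurable (Y n v) := fun v => (hadapt n v).mono (F.le v) le_rfl
  have hcs : ∀ s ∈ Set.Icc r T, ∀ ω, ContinuousOn (fun v => Y n (min v s) ω) (Set.Icc 0 T) := by
    intro s hs ω
    refine (hcont n ω).comp (f := fun v => min v s) (by fun_prop) ?_
    intro v hv
    exact ⟨le_min hv.1 (hr.trans hs.1), (min_le_left _ _).trans hv.2⟩
  -- random quantities
  set D : ℕ → Ω → ℝ≥0∞ := fun i ω =>
    eSupIcc 0 T (fun v => Y n (min v (t n i)) ω - Y n (min v (t n (i - 1))) ω) with hD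
  set N : Ω → ℝ≥0∞ := fun ω => eSupIcc 0 T (fun v => Y n v ω) with hN
  have hDc : ∀ i < k n, ∀ ω, ContinuousOn
      (fun v => Y n (min v (t n i)) ω - Y n (min v (t n (i - 1))) ω) (Set.Icc 0 T) := by
    intro i hi ω
    exact (hcs _ (htI i hi.le) ω).sub (hcs _ (htI (i - 1) (by omega)) ω)
  have hDm : ∀ i < k n, Measurable (D i) := fun i hi =>
    rr_measurable_eSup T (fun v ω => Y n (min v (t n i)) ω - Y n (min v (t n (i - 1))) ω)
      (fun v => (hmeasY _).sub (hmeasY _)) (hDc i hi)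
  have hNm : Measurable N := rr_measurable_eSup T (Y n) hmeasY (hcont n)
  have hNE : ∫⁻ ω, N ω ^ 2 ∂P ≤ ENNReal.ofReal c20 * W :=
    le_self_add.trans (hmom n r ⟨le_rfl, hrT.le⟩ T ⟨hrT.le, le_rfl⟩ hrT.ne)
  have hDE : ∀ i < k n, ∫⁻ ω, D i ω ^ 2 ∂P ≤ ENNReal.ofReal M * (ENNReal.ofReal c20 * W) := by
    intro i hi
    rcases i with _ | i
    · simp [hD, eSupIcc]
    · have hpos := hδ0 i (by omega)
      have h := le_add_self.trans (hmom n (t n (i + 1)) (htI _ hi.le) (t n i) (htI i (by omega))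
        (by linarith))
      rw [abs_of_pos hpos, ENNReal.div_le_iff_le_mul (Or.inl (by simpa using hpos))
        (Or.inl ENNReal.ofReal_ne_top)] at h
      refine h.trans ?_
      rw [mul_comm]
      gcongr
      exact hδM i (by omega)
  have hpath : ∀ ω, (⨆ j, ⨆ _ : j ≤ k n,
          (‖∫ s in Set.Icc r (t n j),
              (gam n s - 1) • G (flo n s) (fun u => Y n u ω)‖₊ : ℝ≥0∞)) ^ 2 ≤
      ENNReal.ofReal ((4 * lam ^ 2 * (T - r) ^ 2 + 4 * c₀ ^ 2 * (T - r)) * M) +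
      ENNReal.ofReal (4 * lam ^ 2 * (T - r)) *
        ∑ i ∈ Finset.range (k n), ENNReal.ofReal (t n (i + 1) - t n i) * D i ω ^ 2 +
      ENNReal.ofReal (4 * c₀ ^ 2 * (T - r) * M) * N ω ^ 2 := by
    intro ω
    set y := supIcc 0 T (fun u => Y n u ω) with hy
    have hy0 : 0 ≤ y := rr_supIcc_nonneg _ _ _
    set d : ℕ → ℝ := fun i => supIcc 0 T
      (fun v => Y n (min v (t n i)) ω - Y n (min v (t n (i - 1))) ω) with hdd
    have hd0 : ∀ i, 0 ≤ d i := fun i => rr_supIcc_nonneg _ _ _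
    set f : ℕ → EuclideanSpace ℝ (Fin m) := fun i => G (t n i) (fun u => Y n u ω) with hf
    set g : ℝ → EuclideanSpace ℝ (Fin m) :=
      fun s => (gam n s - 1) • G (flo n s) (fun u => Y n u ω) with hg
    have hform := rr_integral_formula (t n) (k n) (hmono n) g f
      (by
        intro s hs
        have h1 : gam n s = 0 := (hgam n).1 s (ht0 n ▸ hs)
        have h2 : flo n s = t n 0 := (hflo n).1 0 (hk n) s hs
        simp only [hg, hf, h1, h2]
        simp)
      (by
        intro i hi s hs
        have h1 := (hgam n).2.1 (i + 1) (by omega) hi s hs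
        have h2 := (hflo n).1 (i + 1) hi s hs
        simp only [Nat.add_sub_cancel] at h1 h2
        simp only [hg, hf, h1, h2])
    have hsq := rr_norm_sq (t n) (k n) (hmono n) f M (c₀ * (1 + y)) hδM hM0.le lam d
      (fun i hi => hGgrowth _ (htI i hi.le) _ (hcont n ω))
      (by
        intro i hi
        refine (hlip (t n (i - 1)) (htI (i - 1) (by omega)) (t n i) (htI i hi.le) _ _
          (hcont n ω) (hcont n ω)).trans ?_
        refine mul_le_mul_of_nonneg_left (add_le_add ?_ le_rfl) hlam
        refine Real.rpow_le_rpow (abs_nonneg _) ?_ (by norm_num)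
        rcases i with _ | i
        · simpa using hM0.le
        · rw [Nat.add_sub_cancel, abs_of_pos (hδ0 i (by omega))]
          exact hδM i (by omega))
    rw [ht0 n, htlast n] at hsq
    set R : ℝ := (4 * lam ^ 2 * (T - r) ^ 2 + 4 * c₀ ^ 2 * (T - r)) * M +
      4 * lam ^ 2 * (T - r) * ∑ i ∈ Finset.range (k n), (t n (i + 1) - t n i) * d i ^ 2 +
      4 * c₀ ^ 2 * (T - r) * M * y ^ 2 with hR
    have hS0 : 0 ≤ ∑ i ∈ Finset.range (k n), (t n (i + 1) - t n i) * d i ^ 2 :=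
      Finset.sum_nonneg fun i hi =>
        mul_nonneg (hδ0 i (Finset.mem_range.1 hi)).le (sq_nonneg _)
    have hR0 : 0 ≤ R := by positivity
    have hbound : ∀ j ≤ k n, ‖∫ s in Set.Icc r (t n j), g s‖ ≤ Real.sqrt R := by
      intro j hj
      rcases j with _ | j
      · rw [ht0 n]; simp
      · apply Real.le_sqrt_of_sq_le
        rw [integral_Icc_eq_integral_Ico]
        have h3 := (hform j hj).2.2
        rw [ht0 n] at h3
        rw [h3]
        refine (hsq j hj).trans ?_
        have h4 : (c₀ * (1 + y)) ^ 2 ≤ 2 * c₀ ^ 2 * (1 + y ^ 2) := by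
          nlinarith [mul_nonneg (sq_nonneg c₀) (sq_nonneg (1 - y))]
        have h5 : M ^ 2 ≤ (T - r) * M := by nlinarith
        have h6 : 2 * M ^ 2 * (c₀ * (1 + y)) ^ 2 ≤
            2 * ((T - r) * M) * (2 * c₀ ^ 2 * (1 + y ^ 2)) := by gcongr
        rw [hR]
        linarith
    have hfin : (⨆ j, ⨆ _ : j ≤ k n, (‖∫ s in Set.Icc r (t n j), g s‖₊ : ℝ≥0∞)) ^ 2 ≤
        ENNReal.ofReal R := by
      have h7 : (⨆ j, ⨆ _ : j ≤ k n, (‖∫ s in Set.Icc r (t n j), g s‖₊ : ℝ≥0∞)) ≤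
          ENNReal.ofReal (Real.sqrt R) := by
        refine iSup₂_le fun j hj => ?_
        have := ENNReal.ofReal_le_ofReal (hbound j hj)
        rwa [ofReal_norm_eq_enorm] at this
      calc _ ≤ ENNReal.ofReal (Real.sqrt R) ^ 2 := by gcongr
        _ = ENNReal.ofReal R := by
          rw [← ENNReal.ofReal_pow (Real.sqrt_nonneg _), Real.sq_sqrt hR0]
    refine hfin.trans ?_
    rw [hR, ENNReal.ofReal_add (by positivity) (by positivity),
      ENNReal.ofReal_add (by positivity) (by positivity),
      ENNReal.ofReal_mul (p := 4 * lam ^ 2 * (T - r)) (by positivity),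
      ENNReal.ofReal_mul (p := 4 * c₀ ^ 2 * (T - r) * M) (by positivity),
      ENNReal.ofReal_sum_of_nonneg (fun i hi =>
        mul_nonneg (hδ0 i (Finset.mem_range.1 hi)).le (sq_nonneg _)),
      ENNReal.ofReal_pow hy0]
    refine add_le_add (add_le_add le_rfl (mul_le_mul_right (Finset.sum_le_sum fun i hi => ?_) _)) ?_
    · have hi' := Finset.mem_range.1 hi
      rw [ENNReal.ofReal_mul (hδ0 i hi').le, ENNReal.ofReal_pow (hd0 i)]
      have := rr_ofReal_supIcc_le hT0 _ (hDc i hi' ω)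
      gcongr
    · have := rr_ofReal_supIcc_le hT0 _ (hcont n ω)
      gcongr
  have hsumm : Measurable fun ω =>
      ∑ i ∈ Finset.range (k n), ENNReal.ofReal (t n (i + 1) - t n i) * D i ω ^ 2 :=
    Finset.measurable_fun_sum _ fun i hi =>
      ((hDm i (Finset.mem_range.1 hi)).pow_const 2).const_mul _
  refine (lintegral_mono hpath).trans ?_
  rw [lintegral_add_right _ ((hNm.pow_const 2).const_mul _),
    lintegral_add_left measurable_const, lintegral_const, measure_univ, mul_one,
    lintegral_const_mul _ hsumm, lintegral_const_mul _ (hNm.pow_const 2),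
    lintegral_finsetSum _ fun i hi =>
      ((hDm i (Finset.mem_range.1 hi)).pow_const 2).const_mul _]
  have hsumE : ∑ i ∈ Finset.range (k n),
      ∫⁻ ω, ENNReal.ofReal (t n (i + 1) - t n i) * D i ω ^ 2 ∂P ≤
      ENNReal.ofReal ((T - r) * c20 * M) * W := by
    calc _ ≤ ∑ i ∈ Finset.range (k n), ENNReal.ofReal (t n (i + 1) - t n i) *
          (ENNReal.ofReal M * (ENNReal.ofReal c20 * W)) := by
          refine Finset.sum_le_sum fun i hi => ?_
          have hi' := Finset.mem_range.1 hi
          rw [lintegral_const_mul _ ((hDm i hi').pow_const 2)]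
          have := hDE i hi'
          gcongr
      _ = _ := by
          rw [← Finset.sum_mul, ← ENNReal.ofReal_sum_of_nonneg
            (fun i hi => (hδ0 i (Finset.mem_range.1 hi)).le), Finset.sum_range_sub, ht0, htlast,
            ENNReal.ofReal_mul (by positivity), ENNReal.ofReal_mul hL.le]
          ring
  calc _ ≤ ENNReal.ofReal ((4 * lam ^ 2 * (T - r) ^ 2 + 4 * c₀ ^ 2 * (T - r)) * M) * W +
        ENNReal.ofReal (4 * lam ^ 2 * (T - r)) * (ENNReal.ofReal ((T - r) * c20 * M) * W) +
        ENNReal.ofReal (4 * c₀ ^ 2 * (T - r) * M) * (ENNReal.ofReal c20 * W) := by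
        gcongr
        exact le_mul_of_one_le_right' hW1
    _ = ENNReal.ofReal ((4 * lam ^ 2 * (T - r) ^ 2 + 4 * c₀ ^ 2 * (T - r)) * M +
        4 * lam ^ 2 * (T - r) * ((T - r) * c20 * M) +
        4 * c₀ ^ 2 * (T - r) * M * c20) * W := by
        rw [ENNReal.ofReal_add (by positivity) (by positivity),
          ENNReal.ofReal_add (by positivity) (by positivity),
          ENNReal.ofReal_mul (p := 4 * lam ^ 2 * (T - r)) (by positivity),
          ENNReal.ofReal_mul (p := 4 * c₀ ^ 2 * (T - r) * M) (by positivity)]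
        ring
    _ ≤ _ := by
        gcongr
        nlinarith
end

section
/- Let W be a standard d-dimensional (𝔽_t)-Brownian motion and (𝕋_n)_{n∈ℕ} a balanced sequence of partitions of [r,T]. Let ₙW := L_n(W) be the adapted linear interpolation of W along 𝕋_n, with pathwise derivative ₙẆ on [r,T]. Then for each p,q ≥ 1 there exists ŵ_{p,q} > 0 (one may take ŵ_{p,q} = E[|Z|^{pq}]·c_𝕋^{pq} with Z ~ N(0,I_d)) such that E[ ( ∫_s^t |ₙẆ_u|^q du )^p ] ≤ ŵ_{p,q} · |𝕋_n|^{−pq/2} · (t−s)^p for all n ∈ ℕ and s,t ∈ [r,T] with s ≤ t. -/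
open MeasureTheory Set Filter ENNReal

lemma aux_gauss_finite (d : ℕ) (m : ℝ) (hm : 0 < m) :
    ∫⁻ z, ‖(WithLp.toLp 2 z : EuclideanSpace ℝ (Fin d))‖ₑ ^ m
      ∂(Measure.pi (fun _ : Fin d => ProbabilityTheory.gaussianReal 0 1)) < ∞ := by
  set μ := Measure.pi (fun _ : Fin d => ProbabilityTheory.gaussianReal 0 1) with hμ
  have h1 : MemLp (id : (Fin d → ℝ) → (Fin d → ℝ)) (ENNReal.ofReal m) μ :=
    MemLp.of_eval fun i => (ProbabilityTheory.memLp_id_gaussianReal' _ ENNReal.ofReal_ne_top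
      ).comp_measurePreserving (measurePreserving_eval _ i)
  have h2 : MemLp (fun z : Fin d → ℝ => (WithLp.toLp 2 z : EuclideanSpace ℝ (Fin d)))
      (ENNReal.ofReal m) μ :=
    ((PiLp.continuousLinearEquiv 2 ℝ (fun _ : Fin d => ℝ)).symm :
      (Fin d → ℝ) →L[ℝ] EuclideanSpace ℝ (Fin d)).comp_memLp' h1
  have h3 := lintegral_rpow_enorm_lt_top_of_eLpNorm_lt_top (by simpa using hm)
    ENNReal.ofReal_ne_top h2.eLpNorm_lt_top
  rwa [ENNReal.toReal_ofReal hm.le] at h3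

lemma aux_incr {d : ℕ} {Ω : Type*} {mΩ : MeasurableSpace Ω} {P : Measure Ω}
    {D : Ω → EuclideanSpace ℝ (Fin d)} (hD : Measurable D) {h : ℝ} (hh : 0 ≤ h)
    (hlaw : P.map (fun ω => (fun l => D ω l : Fin d → ℝ)) =
      Measure.pi (fun _ : Fin d => ProbabilityTheory.gaussianReal 0 (Real.toNNReal h)))
    (m : ℝ) (hm : 0 < m) :
    ∫⁻ ω, ‖D ω‖ₑ ^ m ∂P = ENNReal.ofReal (√h) ^ m *
      ∫⁻ z, ‖(WithLp.toLp 2 z : EuclideanSpace ℝ (Fin d))‖ₑ ^ m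
      ∂(Measure.pi (fun _ : Fin d => ProbabilityTheory.gaussianReal 0 1)) := by
  have hmeas : Measurable (fun z : Fin d → ℝ =>
      ‖(WithLp.toLp 2 z : EuclideanSpace ℝ (Fin d))‖ₑ ^ m) := by fun_prop
  have h1 : ∫⁻ ω, ‖D ω‖ₑ ^ m ∂P = ∫⁻ z, ‖(WithLp.toLp 2 z : EuclideanSpace ℝ (Fin d))‖ₑ ^ m
      ∂(P.map (fun ω => (fun l => D ω l : Fin d → ℝ))) := by
    rw [lintegral_map hmeas (by fun_prop)]
  have h2 : Measure.pi (fun _ : Fin d => ProbabilityTheory.gaussianReal 0 (Real.toNNReal h)) =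
      (Measure.pi (fun _ : Fin d => ProbabilityTheory.gaussianReal 0 1)).map
        (fun z i => √h * z i) := by
    rw [Measure.pi_map_pi (fun i => by fun_prop)]
    congr 1
    funext i
    rw [ProbabilityTheory.gaussianReal_map_const_mul]
    congr 1
    · simp
    · ext
      simp [Real.sq_sqrt hh, hh]
  rw [h1, hlaw, h2, lintegral_map hmeas (by fun_prop), ← lintegral_const_mul _ hmeas]
  congr 1
  funext z
  have : (WithLp.toLp 2 (fun i => √h * z i) : EuclideanSpace ℝ (Fin d)) =
      √h • (WithLp.toLp 2 z : EuclideanSpace ℝ (Fin d)) := by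
    ext i; simp
  rw [this, enorm_smul, ENNReal.mul_rpow_of_nonneg _ _ hm.le, Real.enorm_of_nonneg (by positivity)]

lemma aux_jensen {α : Type*} {mα : MeasurableSpace α} (μ : Measure α) (f : α → ℝ≥0∞)
    (hf : Measurable f) (p : ℝ) (hp : 1 ≤ p) :
    (∫⁻ a, f a ∂μ) ^ p ≤ (∫⁻ a, f a ^ p ∂μ) * μ Set.univ ^ (p - 1) := by
  have hp0 : 0 < p := by linarith
  have h := eLpNorm'_le_eLpNorm'_mul_rpow_measure_univ (μ := μ) (f := f) one_pos hp
    hf.aestronglyMeasurable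
  simp only [eLpNorm'_eq_lintegral_enorm, enorm_eq_self, ENNReal.rpow_one, div_one] at h
  have h2 := ENNReal.rpow_le_rpow h hp0.le
  rw [ENNReal.mul_rpow_of_nonneg _ _ hp0.le, ← ENNReal.rpow_mul, ← ENNReal.rpow_mul] at h2
  have e1 : 1 / p * p = 1 := by field_simp
  have e2 : (1 - 1 / p) * p = p - 1 := by field_simp
  rwa [e1, e2, ENNReal.rpow_one] at h2

lemma aux_mono {K : ℕ} {τ : ℕ → ℝ} (h : ∀ i < K, τ i < τ (i + 1)) {i j : ℕ} (hij : i ≤ j)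
    (hj : j ≤ K) : τ i ≤ τ j := by
  induction j, hij using Nat.le_induction with
  | base => exact le_rfl
  | succ j hj' ih => exact (ih (by omega)).trans (h j (by omega)).le

lemma aux_cover {K : ℕ} {τ : ℕ → ℝ} {v : ℝ}
    (h0 : τ 0 ≤ v) (hK : v ≤ τ K) (hne : ∀ i ≤ K, v ≠ τ i) :
    ∃ i < K, v ∈ Set.Ioo (τ i) (τ (i + 1)) := by
  induction K with
  | zero => exact absurd (le_antisymm hK h0) (hne 0 le_rfl)
  | succ K ih =>
    by_cases hv : v ≤ τ K
    · obtain ⟨i, hi, hi'⟩ := ih hv (fun i hi => hne i (by omega))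
      exact ⟨i, by omega, hi'⟩
    · exact ⟨K, by omega, not_le.mp hv, lt_of_le_of_ne hK (hne _ le_rfl)⟩

lemma aux_main {Ω : Type*} {mΩ : MeasurableSpace Ω} (P : Measure Ω) [IsProbabilityMeasure P]
    {K : ℕ} {τ : ℕ → ℝ} (hmono : ∀ i < K, τ i < τ (i + 1))
    (X : ℕ → Ω → ℝ≥0∞) (hX : ∀ i, Measurable (X i)) (g : ℝ → Ω → ℝ≥0∞)
    (hg : ∀ ω, ∀ i < K, ∀ v ∈ Set.Ioo (τ i) (τ (i + 1)), g v ω = X i ω)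
    (p : ℝ) (hp : 1 ≤ p) (C : ℝ≥0∞) (hC : ∀ i < K, ∫⁻ ω, X i ω ^ p ∂P ≤ C)
    (s u : ℝ) (hs : τ 0 ≤ s) (hu : u ≤ τ K) :
    ∫⁻ ω, (∫⁻ v in Set.Icc s u, g v ω) ^ p ∂P ≤ C * ENNReal.ofReal (u - s) ^ p := by
  have hp0 : 0 < p := by linarith
  set G : ℝ → Ω → ℝ≥0∞ := fun v ω =>
    ∑ i ∈ Finset.range K, (Set.Ioo (τ i) (τ (i + 1))).indicator (fun _ => X i ω) v with hG
  have hGm : Measurable (Function.uncurry G) := by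
    have : Function.uncurry G = fun x : ℝ × Ω => ∑ i ∈ Finset.range K,
        ((Prod.fst : ℝ × Ω → ℝ) ⁻¹' Set.Ioo (τ i) (τ (i + 1))).indicator
          (fun x => X i x.2) x := by
      funext ⟨v, ω⟩
      simp [hG, Function.uncurry, Set.indicator]
    rw [this]
    refine Finset.measurable_sum _ (fun i _ => ?_)
    exact ((hX i).comp measurable_snd).indicator (measurable_fst measurableSet_Ioo)
  have hGi : ∀ i < K, ∀ v ∈ Set.Ioo (τ i) (τ (i + 1)), ∀ ω, G v ω = X i ω := by
    intro i hi v hv ω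
    simp only [hG]
    rw [Finset.sum_eq_single i]
    · rw [Set.indicator_of_mem hv]
    · intro j hj hji
      apply Set.indicator_of_notMem
      rintro ⟨h1, h2⟩
      have hj := Finset.mem_range.mp hj
      rcases lt_or_gt_of_ne hji with h | h
      · have := aux_mono hmono (show j + 1 ≤ i by omega) hi.le
        linarith [hv.1]
      · have := aux_mono hmono (show i + 1 ≤ j by omega) hj.le
        linarith [hv.2]
    · intro h; exact absurd (Finset.mem_range.mpr hi) h
  have hae : ∀ᵐ v ∂(volume.restrict (Set.Icc s u)),
      ∃ i < K, v ∈ Set.Ioo (τ i) (τ (i + 1)) := by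
    have hfin : (τ '' Set.Iic K).Finite := (Set.finite_Iic K).image _
    have h1 : ∀ᵐ v ∂(volume : Measure ℝ), v ∉ τ '' Set.Iic K :=
      measure_eq_zero_iff_ae_notMem.mp (hfin.measure_zero _)
    filter_upwards [ae_restrict_mem measurableSet_Icc, ae_restrict_of_ae h1] with v hv hv'
    exact aux_cover (hs.trans hv.1) (hv.2.trans hu) (fun i hi h => hv' ⟨i, hi, h.symm⟩)
  calc ∫⁻ ω, (∫⁻ v in Set.Icc s u, g v ω) ^ p ∂P
      = ∫⁻ ω, (∫⁻ v in Set.Icc s u, G v ω) ^ p ∂P := by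
        congr 1; funext ω; congr 1
        apply lintegral_congr_ae
        filter_upwards [hae] with v ⟨i, hi, hv⟩
        rw [hg ω i hi v hv, hGi i hi v hv]
    _ ≤ ∫⁻ ω, (∫⁻ v in Set.Icc s u, G v ω ^ p) * ENNReal.ofReal (u - s) ^ (p - 1) ∂P := by
        refine lintegral_mono fun ω => ?_
        have := aux_jensen (volume.restrict (Set.Icc s u)) (fun v => G v ω)
          (hGm.comp (measurable_id.prodMk measurable_const)) p hp
        simpa using this
    _ = (∫⁻ v in Set.Icc s u, ∫⁻ ω, G v ω ^ p ∂P) * ENNReal.ofReal (u - s) ^ (p - 1) := by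
        rw [lintegral_mul_const' _ _ (by
          exact ENNReal.rpow_ne_top_of_nonneg (by linarith) ENNReal.ofReal_ne_top)]
        rw [lintegral_lintegral_swap]
        exact ((hGm.pow_const p).comp measurable_swap).aemeasurable
    _ ≤ (∫⁻ v in Set.Icc s u, C) * ENNReal.ofReal (u - s) ^ (p - 1) := by
        gcongr 1
        apply lintegral_mono_ae
        filter_upwards [hae] with v ⟨i, hi, hv⟩
        simp only [hGi i hi v hv]
        exact hC i hi
    _ = C * ENNReal.ofReal (u - s) ^ p := by
        simp only [lintegral_const, Measure.restrict_apply MeasurableSet.univ, Set.univ_inter,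
          Real.volume_Icc]
        rw [mul_assoc]
        congr 1
        nth_rewrite 1 [← ENNReal.rpow_one (ENNReal.ofReal (u - s))]
        rw [← ENNReal.rpow_add_of_nonneg _ _ zero_le_one (by linarith)]
        congr 1; ring


open MeasureTheory Set Filter ENNReal

noncomputable section

/-- `W` is a standard `d`-dimensional `(𝔽_t)`-Brownian motion on `[0,T]`: adapted with
continuous paths started at `0`, and for `0 ≤ s ≤ t ≤ T` the increment `W_t − W_s` is
independent of `𝔽_s` and has the Gaussian distribution `N(0, (t−s)·I_d)`. -/
structure IsStdBM {Ω : Type*} {mΩ : MeasurableSpace Ω} (d : ℕ)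
    (F : MeasureTheory.Filtration ℝ mΩ) (P : MeasureTheory.Measure Ω) (T : ℝ)
    (W : ℝ → Ω → EuclideanSpace ℝ (Fin d)) : Prop where
  adapted : MeasureTheory.Adapted F W
  cont : ∀ ω, ContinuousOn (fun t => W t ω) (Set.Icc 0 T)
  init : ∀ ω, W 0 ω = 0
  indep : ∀ s t : ℝ, 0 ≤ s → s ≤ t → t ≤ T →
    ProbabilityTheory.Indep
      (MeasurableSpace.comap (fun ω => W t ω - W s ω) inferInstance) (F s) P
  law : ∀ s t : ℝ, 0 ≤ s → s ≤ t → t ≤ T →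
    P.map (fun ω => (fun l => W t ω l - W s ω l : Fin d → ℝ)) =
      MeasureTheory.Measure.pi
        (fun _ : Fin d => ProbabilityTheory.gaussianReal 0 (Real.toNNReal (t - s)))

end

/-- **Integral moment estimate for adapted linear interpolations of Brownian motion**
(Lemma 3.10 / Statement 12): for every `p,q ≥ 1` there is `ŵ_{p,q} > 0` with
`E[(∫_s^t |ₙẆ_u|^q du)^p] ≤ ŵ_{p,q} |𝕋_n|^{−pq/2} (t−s)^p` for all `n` and
`r ≤ s ≤ t ≤ T`, where `ₙẆ` is the pathwise derivative of the adapted linear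
interpolation `ₙW = L_n(W)`. -/
theorem brownian_interpolation_integral_moments {d : ℕ} (r T : ℝ) (hr : 0 ≤ r) (hrT : r < T)
    {Ω : Type*} {mΩ : MeasurableSpace Ω} (P : Measure Ω) [IsProbabilityMeasure P]
    (F : Filtration ℝ mΩ)
    (W : ℝ → Ω → EuclideanSpace ℝ (Fin d)) (hW : IsStdBM d F P T W)
    (k : ℕ → ℕ) (t : ℕ → ℕ → ℝ)
    (hk : ∀ n, 0 < k n) (ht0 : ∀ n, t n 0 = r) (htlast : ∀ n, t n (k n) = T)
    (hmono : ∀ n, ∀ i < k n, t n i < t n (i + 1))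
    (cT : ℝ) (hcT : 1 ≤ cT)
    (hbal : ∀ n, ∀ i < k n, pmesh k t n ≤ cT * (t n (i + 1) - t n i))
    (W' : ℕ → ℝ → Ω → EuclideanSpace ℝ (Fin d))
    (hW' : ∀ n (ω : Ω),
      (∀ u ∈ Set.Ioo r (t n 1), W' n u ω = 0) ∧
      ∀ i, 1 ≤ i → i < k n → ∀ u ∈ Set.Ioo (t n i) (t n (i + 1)),
        W' n u ω = ((t n (i + 1) - t n i)⁻¹) • (W (t n i) ω - W (t n (i - 1)) ω))
    (p q : ℝ) (hp : 1 ≤ p) (hq : 1 ≤ q) :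
    ∃ w > (0:ℝ), ∀ n, ∀ s ∈ Set.Icc r T, ∀ u ∈ Set.Icc r T, s ≤ u →
      ∫⁻ ω, ENNReal.ofReal ((∫ v in Set.Icc s u, ‖W' n v ω‖ ^ q) ^ p) ∂P ≤
        ENNReal.ofReal (w * pmesh k t n ^ (-(p * q) / 2) * (u - s) ^ p) := by
  have hm : 0 < p * q := by positivity
  set C0 := ∫⁻ z, ‖(WithLp.toLp 2 z : EuclideanSpace ℝ (Fin d))‖ₑ ^ (p * q)
      ∂(Measure.pi (fun _ : Fin d => ProbabilityTheory.gaussianReal 0 1)) with hC0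
  have hC0f : C0 ≠ ∞ := (aux_gauss_finite d (p * q) hm).ne
  refine ⟨cT ^ (p * q) * (C0.toReal + 1), by positivity, ?_⟩
  intro n s hs u hu hsu
  set M := pmesh k t n with hM
  have hle : ∀ i < k n, t n (i + 1) - t n i ≤ M := fun i hi =>
    le_csSup ((Set.finite_Iio (k n)).image _).bddAbove ⟨i, hi, rfl⟩
  have hMpos : 0 < M := by
    have := hle 0 (hk n); have := hmono n 0 (hk n); linarith
  have hWm : ∀ a, Measurable (W a) := fun a => (hW.adapted a).mono (F.le a) le_rfl
  set D : ℕ → Ω → EuclideanSpace ℝ (Fin d) := fun i ω => W (t n i) ω - W (t n (i - 1)) ω with hD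
  have hDm : ∀ i, Measurable (D i) := fun i => (hWm _).sub (hWm _)
  set X : ℕ → Ω → ℝ≥0∞ := fun i ω => ‖((t n (i + 1) - t n i)⁻¹) • D i ω‖ₑ ^ q with hX
  have hXm : ∀ i, Measurable (X i) := fun i =>
    (((hDm i).const_smul ((t n (i + 1) - t n i)⁻¹)).enorm).pow_const q
  have hint : ∀ i < k n, ∫⁻ ω, X i ω ^ p ∂P ≤ ENNReal.ofReal (cT * M ^ (-(1:ℝ)/2)) ^ (p * q) * C0 := by
    intro i hi
    have hΔ : 0 < t n (i + 1) - t n i := sub_pos.mpr (hmono n i hi)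
    have h1 : t n (i - 1) ≤ t n i := aux_mono (hmono n) (by omega) hi.le
    have h2 : t n i - t n (i - 1) ≤ M := by
      rcases Nat.eq_zero_or_pos i with h | h
      · subst h; simpa using hMpos.le
      · have := hle (i - 1) (by omega)
        rwa [Nat.sub_add_cancel h] at this
    have h3 : 0 ≤ t n (i - 1) := hr.trans ((ht0 n).symm.le.trans
      (aux_mono (hmono n) (Nat.zero_le _) (by omega)))
    have h4 : t n i ≤ T := (aux_mono (hmono n) hi.le le_rfl).trans (htlast n).le
    have h5 := aux_incr (P := P) (hDm i) (sub_nonneg.mpr h1) (hW.law _ _ h3 h1 h4) (p * q) hm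
    have h6 : ∀ ω, X i ω ^ p =
        ENNReal.ofReal ((t n (i + 1) - t n i)⁻¹) ^ (p * q) * ‖D i ω‖ₑ ^ (p * q) := by
      intro ω
      simp only [hX]
      rw [← ENNReal.rpow_mul, mul_comm q p, enorm_smul, ENNReal.mul_rpow_of_nonneg _ _ hm.le,
        Real.enorm_of_nonneg (by positivity)]
    simp_rw [h6]
    rw [lintegral_const_mul _ ((hDm i).enorm.pow_const _), h5, ← mul_assoc,
      ← ENNReal.mul_rpow_of_nonneg _ _ hm.le, ← ENNReal.ofReal_mul (by positivity)]
    gcongr ENNReal.ofReal ?_ ^ _ * _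
    have h7 : √(t n i - t n (i - 1)) ≤ √M := Real.sqrt_le_sqrt h2
    have h8 : (t n (i + 1) - t n i)⁻¹ ≤ cT * M⁻¹ := by
      rw [inv_le_comm₀ hΔ (by positivity), mul_inv, inv_inv, inv_mul_le_iff₀ (by positivity)]
      exact hbal n i hi
    calc _ ≤ cT * M⁻¹ * √M := by gcongr
      _ = cT * M ^ (-(1:ℝ)/2) := by
        rw [mul_assoc, Real.sqrt_eq_rpow, ← Real.rpow_neg_one M, ← Real.rpow_add hMpos]
        norm_num
  have key := aux_main P (hmono n) X hXm (fun v ω => ‖W' n v ω‖ₑ ^ q) (by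
    intro ω i hi v hv
    simp only [hX]
    congr 2
    rcases Nat.eq_zero_or_pos i with h | h
    · subst h
      rw [(hW' n ω).1 v (by simpa [ht0 n] using hv)]
      simp [hD]
    · exact (hW' n ω).2 i h hi v hv) p hp _ hint s u (by rw [ht0]; exact hs.1)
      (by rw [htlast]; exact hu.2)
  calc _ ≤ ∫⁻ ω, (∫⁻ v in Set.Icc s u, ‖W' n v ω‖ₑ ^ q) ^ p ∂P := by
        refine lintegral_mono fun ω => ?_
        have h0 : 0 ≤ ∫ v in Set.Icc s u, ‖W' n v ω‖ ^ q :=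
          integral_nonneg fun v => by positivity
        rw [← ENNReal.ofReal_rpow_of_nonneg h0 (by linarith), ← Real.enorm_of_nonneg h0]
        gcongr
        refine (enorm_integral_le_lintegral_enorm _).trans (le_of_eq ?_)
        congr 1; funext v
        rw [Real.enorm_rpow_of_nonneg (norm_nonneg _) (by linarith), enorm_norm]
    _ ≤ _ := key
    _ ≤ _ := by
        have hus : 0 ≤ u - s := sub_nonneg.mpr hsu
        have e : (cT * M ^ (-(1:ℝ)/2)) ^ (p * q) = cT ^ (p * q) * M ^ (-(p * q) / 2) := by
          rw [Real.mul_rpow (by positivity) (by positivity), ← Real.rpow_mul hMpos.le]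
          congr 2; ring
        rw [ENNReal.ofReal_rpow_of_nonneg (by positivity) hm.le, e,
          ENNReal.ofReal_rpow_of_nonneg hus (by linarith), ← ENNReal.ofReal_toReal hC0f,
          ← ENNReal.ofReal_mul (by positivity), ← ENNReal.ofReal_mul (by positivity)]
        apply ENNReal.ofReal_le_ofReal
        gcongr ?_ * _
        have : 0 ≤ cT ^ (p * q) * M ^ (-(p * q) / 2) := by positivity
        rw [ENNReal.ofReal_toReal hC0f]
        nlinarith
end

section
/- Let W be a standard d-dimensional (𝔽_t)-Brownian motion, (𝕋_n)_{n∈ℕ} a balanced sequence of partitions of [r,T], and ₙW := L_n(W) with pathwise derivative ₙẆ. Let (ₙX)_{n∈ℕ} be a sequence of ℝ₊-valued measurable processes for which there are p > 2 and c_p > 0 such that E[ₙX_s^p] ≤ c_p |𝕋_n|^p for each s ∈ [r,T) and n ∈ ℕ. Then there exists c₂ > 0 such that E[ ( ∫_r^T ₙX_s · |ₙẆ_s| ds )² ] ≤ c₂ · |𝕋_n| for all n ∈ ℕ. -/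
open MeasureTheory Set Filter ENNReal

open ProbabilityTheory in
lemma gauss_moment (q : ℝ≥0∞) (a : ℝ) (ha : 0 ≤ a) :
    eLpNorm (id : ℝ → ℝ) q (gaussianReal 0 (Real.toNNReal a)) =
      ENNReal.ofReal (Real.sqrt a) * eLpNorm (id : ℝ → ℝ) q (gaussianReal 0 1) := by
  have h : gaussianReal 0 (Real.toNNReal a)
      = (gaussianReal 0 1).map (Real.sqrt a * ·) := by
    rw [gaussianReal_map_const_mul]
    congr 1
    · simp
    · ext
      simp [ha]
  rw [h, eLpNorm_map_measure (by fun_prop) (by fun_prop)]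
  have : (id ∘ fun x => Real.sqrt a * x) = (Real.sqrt a) • (id : ℝ → ℝ) := by
    ext x; simp
  rw [this, eLpNorm_const_smul, Real.enorm_eq_ofReal (Real.sqrt_nonneg a)]

open ProbabilityTheory in
lemma incr_moment {d : ℕ} {T : ℝ} {Ω : Type*} {mΩ : MeasurableSpace Ω} (P : Measure Ω)
    [IsProbabilityMeasure P] (F : Filtration ℝ mΩ)
    (W : ℝ → Ω → EuclideanSpace ℝ (Fin d)) (hW : IsStdBM d F P T W)
    (q : ℝ≥0∞) (hq : 1 ≤ q) (s t : ℝ) (hs : 0 ≤ s) (hst : s ≤ t) (htT : t ≤ T) :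
    eLpNorm (fun ω => W t ω - W s ω) q P ≤
      (d * eLpNorm (id : ℝ → ℝ) q (gaussianReal 0 1)) * ENNReal.ofReal (Real.sqrt (t - s)) := by
  have hmeas : ∀ u, Measurable (W u) := fun u => (hW.adapted u).mono (F.le u) le_rfl
  have hml : ∀ u l, Measurable (fun ω => W u ω l) := fun u l =>
    (measurable_pi_apply l).comp ((WithLp.measurable_ofLp 2 _).comp (hmeas u))
  have hl : ∀ l : Fin d, eLpNorm (fun ω => W t ω l - W s ω l) q P =
      ENNReal.ofReal (Real.sqrt (t - s)) * eLpNorm (id : ℝ → ℝ) q (gaussianReal 0 1) := by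
    intro l
    have h1 : P.map (fun ω => W t ω l - W s ω l) = gaussianReal 0 (Real.toNNReal (t - s)) := by
      have h2 := hW.law s t hs hst htT
      have h3 := (measurePreserving_eval
        (fun _ : Fin d => gaussianReal 0 (Real.toNNReal (t - s))) l).map_eq
      rw [← h2, Measure.map_map (measurable_pi_apply l)] at h3
      · exact h3
      · exact measurable_pi_lambda _ fun l => (hml t l).sub (hml s l)
    have h4 : Measurable (fun ω => W t ω l - W s ω l) := (hml t l).sub (hml s l)
    rw [← gauss_moment q _ (sub_nonneg.2 hst), ← h1,
      eLpNorm_map_measure (by fun_prop) h4.aemeasurable]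
    rfl
  calc eLpNorm (fun ω => W t ω - W s ω) q P
      ≤ eLpNorm (∑ l : Fin d, fun ω => ‖W t ω l - W s ω l‖) q P := by
        refine eLpNorm_mono_real fun ω => ?_
        rw [Finset.sum_apply]
        have h0 : W t ω - W s ω = ∑ l, EuclideanSpace.single l ((W t ω - W s ω) l) := by
          ext j
          simp [Finset.sum_apply, Pi.single_apply]
        rw [h0]
        refine (norm_sum_le _ _).trans (le_of_eq ?_)
        refine Finset.sum_congr rfl fun l _ => ?_
        simp
    _ ≤ ∑ l : Fin d, eLpNorm (fun ω => ‖W t ω l - W s ω l‖) q P :=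
        eLpNorm_sum_le
          (fun l _ => (((hml t l).sub (hml s l)).norm).aestronglyMeasurable) hq
    _ = _ := by
        simp_rw [eLpNorm_norm, hl]
        simp
        ring

lemma part_exists (k : ℕ) (t : ℕ → ℝ) (s : ℝ) (h0 : t 0 < s) (h1 : s ≤ t k) :
    ∃ i < k, t i < s ∧ s ≤ t (i + 1) := by
  induction k with
  | zero => linarith
  | succ k ih =>
    by_cases h : s ≤ t k
    · obtain ⟨i, hi, h⟩ := ih h
      exact ⟨i, by omega, h⟩
    · exact ⟨k, by omega, not_le.1 h, h1⟩

lemma part_mono (k : ℕ) (t : ℕ → ℝ) (h : ∀ i < k, t i < t (i + 1)) (i j : ℕ) (hij : i ≤ j)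
    (hj : j ≤ k) : t i ≤ t j := by
  induction j, hij using Nat.le_induction with
  | base => exact le_rfl
  | succ j _ ih => exact (ih (by omega)).trans (h j (by omega)).le

lemma part_unique (k : ℕ) (t : ℕ → ℝ) (h : ∀ i < k, t i < t (i + 1)) (i j : ℕ) (hi : i < k)
    (hj : j < k) (s : ℝ) (hsi : s ∈ Ioo (t i) (t (i + 1))) (hsj : s ∈ Ioo (t j) (t (j + 1))) :
    i = j := by
  by_contra hne
  rcases lt_or_gt_of_ne hne with hlt | hlt
  · have := part_mono k t h (i + 1) j hlt hj.le
    linarith [hsi.2, hsj.1]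
  · have := part_mono k t h (j + 1) i hlt hi.le
    linarith [hsi.1, hsj.2]

/-- Cauchy–Schwarz on a bounded interval. -/
lemma cs_interval (r T : ℝ) (hrT : r < T) (g : ℝ → ℝ≥0∞) (hg : Measurable g) :
    (∫⁻ s in Icc r T, g s) ^ 2 ≤ ENNReal.ofReal (T - r) * ∫⁻ s in Icc r T, g s ^ 2 := by
  have h := ENNReal.lintegral_mul_le_Lp_mul_Lq (volume.restrict (Icc r T))
    Real.HolderConjugate.two_two hg.aemeasurable (aemeasurable_const (b := (1 : ℝ≥0∞)))
  simp only [Pi.mul_apply, mul_one, ENNReal.one_rpow, lintegral_const, one_mul,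
    Measure.restrict_apply MeasurableSet.univ, univ_inter, Real.volume_Icc] at h
  refine (pow_le_pow_left' h 2).trans (le_of_eq ?_)
  rw [mul_pow, ← ENNReal.rpow_natCast, ← ENNReal.rpow_natCast, ← ENNReal.rpow_mul,
    ← ENNReal.rpow_mul]
  norm_num
  rw [mul_comm]

/-- The step-function version of the integral bound, given a pointwise moment bound. -/
lemma integral_bound {d : ℕ} (r T : ℝ) (hrT : r < T)
    {Ω : Type*} {mΩ : MeasurableSpace Ω} (P : Measure Ω) [IsProbabilityMeasure P]
    (X : ℝ → Ω → ℝ) (hXm : Measurable fun p : ℝ × Ω => X p.1 p.2)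
    (W' V : ℝ → Ω → EuclideanSpace ℝ (Fin d))
    (hV : Measurable fun p : ℝ × Ω => V p.1 p.2)
    (hVW : ∀ᵐ s ∂(volume.restrict (Icc r T)), ∀ ω, W' s ω = V s ω)
    (B : ℝ≥0∞)
    (hB : ∀ᵐ s ∂(volume.restrict (Icc r T)), eLpNorm (X s • fun ω => ‖V s ω‖) 2 P ≤ B) :
    ∫⁻ ω, ENNReal.ofReal ((∫ s in Set.Icc r T, X s ω * ‖W' s ω‖) ^ 2) ∂P ≤
      ENNReal.ofReal (T - r) * (ENNReal.ofReal (T - r) * B ^ 2) := by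
  have hm : Measurable fun p : ℝ × Ω => ‖X p.1 p.2 * ‖V p.1 p.2‖‖ₑ :=
    (hXm.mul hV.norm).enorm
  calc ∫⁻ ω, ENNReal.ofReal ((∫ s in Set.Icc r T, X s ω * ‖W' s ω‖) ^ 2) ∂P
      ≤ ∫⁻ ω, ENNReal.ofReal (T - r) * (∫⁻ s in Icc r T, ‖X s ω * ‖V s ω‖‖ₑ ^ 2) ∂P := by
        refine lintegral_mono fun ω => ?_
        refine le_trans ?_ (cs_interval r T hrT (fun s => ‖X s ω * ‖V s ω‖‖ₑ)
          (hm.comp measurable_prodMk_right))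
        have e : ∫ s in Set.Icc r T, X s ω * ‖W' s ω‖ = ∫ s in Set.Icc r T, X s ω * ‖V s ω‖ :=
          integral_congr_ae (hVW.mono fun s hs => by simp only [hs ω])
        rw [e, ← sq_abs, ENNReal.ofReal_pow (abs_nonneg _), ← Real.enorm_eq_ofReal_abs]
        exact pow_le_pow_left' (enorm_integral_le_lintegral_enorm _) 2
    _ = ENNReal.ofReal (T - r) * ∫⁻ s in Icc r T, ∫⁻ ω, ‖X s ω * ‖V s ω‖‖ₑ ^ 2 ∂P := by
        rw [lintegral_const_mul' _ _ ENNReal.ofReal_ne_top, lintegral_lintegral_swap]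
        exact ((hm.comp measurable_swap).pow_const 2).aemeasurable
    _ ≤ ENNReal.ofReal (T - r) * ∫⁻ s in Icc r T, B ^ 2 := by
        refine mul_le_mul' le_rfl ?_
        refine lintegral_mono_ae (hB.mono fun s hs => ?_)
        refine le_trans (le_of_eq ?_) (pow_le_pow_left' hs 2)
        rw [eLpNorm_eq_lintegral_rpow_enorm_toReal (by simp) (by simp),
          ← ENNReal.rpow_natCast, ← ENNReal.rpow_mul]
        simp
    _ = _ := by
        simp [mul_comm]

/-- **Second-moment bound for weighted integrals against `|ₙẆ|`**
(Lemma 3.11 / Statement 13): if `ₙX ≥ 0` are measurable processes with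
`E[ₙX_s^p] ≤ c_p |𝕋_n|^p` for some `p > 2`, then there is `c₂ > 0` with
`E[(∫_r^T ₙX_s |ₙẆ_s| ds)²] ≤ c₂ |𝕋_n|` for all `n`. -/
theorem weighted_interpolation_integral_second_moment {d : ℕ} (r T : ℝ)
    (hr : 0 ≤ r) (hrT : r < T)
    {Ω : Type*} {mΩ : MeasurableSpace Ω} (P : Measure Ω) [IsProbabilityMeasure P]
    (F : Filtration ℝ mΩ)
    (W : ℝ → Ω → EuclideanSpace ℝ (Fin d)) (hW : IsStdBM d F P T W)
    (k : ℕ → ℕ) (t : ℕ → ℕ → ℝ)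
    (hk : ∀ n, 0 < k n) (ht0 : ∀ n, t n 0 = r) (htlast : ∀ n, t n (k n) = T)
    (hmono : ∀ n, ∀ i < k n, t n i < t n (i + 1))
    (cT : ℝ) (hcT : 1 ≤ cT)
    (hbal : ∀ n, ∀ i < k n, pmesh k t n ≤ cT * (t n (i + 1) - t n i))
    (W' : ℕ → ℝ → Ω → EuclideanSpace ℝ (Fin d))
    (hW' : ∀ n (ω : Ω),
      (∀ u ∈ Set.Ioo r (t n 1), W' n u ω = 0) ∧
      ∀ i, 1 ≤ i → i < k n → ∀ u ∈ Set.Ioo (t n i) (t n (i + 1)),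
        W' n u ω = ((t n (i + 1) - t n i)⁻¹) • (W (t n i) ω - W (t n (i - 1)) ω))
    (X : ℕ → ℝ → Ω → ℝ)
    (hXpos : ∀ n s ω, 0 ≤ X n s ω)
    (hXmeas : ∀ n, Measurable fun p : ℝ × Ω => X n p.1 p.2)
    (p cp : ℝ) (hp : 2 < p) (hcp : 0 < cp)
    (hmom : ∀ n, ∀ s ∈ Set.Ico r T,
      ∫⁻ ω, ENNReal.ofReal (X n s ω) ^ p ∂P ≤ ENNReal.ofReal (cp * pmesh k t n ^ p)) :
    ∃ c₂ > (0:ℝ), ∀ n,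
      ∫⁻ ω, ENNReal.ofReal ((∫ s in Set.Icc r T, X n s ω * ‖W' n s ω‖) ^ 2) ∂P ≤
        ENNReal.ofReal (c₂ * pmesh k t n) := by
  classical
  have hP0 : 0 < p := by linarith
  set pe : ℝ≥0∞ := ENNReal.ofReal p with hpe
  set q : ℝ≥0∞ := (2⁻¹ - pe⁻¹)⁻¹ with hq
  have hpe2 : (2 : ℝ≥0∞) < pe := by
    rw [hpe]
    have := (ENNReal.ofReal_lt_ofReal_iff hP0).2 hp
    simpa using this
  have hinv : pe⁻¹ < 2⁻¹ := ENNReal.inv_lt_inv.2 hpe2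
  have hqtop : q ≠ ⊤ := by
    rw [hq, Ne, ENNReal.inv_eq_top, tsub_eq_zero_iff_le, not_le]
    exact hinv
  have hq1 : 1 ≤ q := by
    rw [hq, ENNReal.one_le_inv]
    refine tsub_le_self.trans ?_
    simp
  haveI hH : ENNReal.HolderTriple pe q 2 := ⟨by
    rw [hq, inv_inv]
    exact add_tsub_cancel_of_le hinv.le⟩
  set K : ℝ≥0∞ := d * eLpNorm (id : ℝ → ℝ) q (ProbabilityTheory.gaussianReal 0 1) with hK
  have hKtop : K ≠ ⊤ :=
    ENNReal.mul_ne_top (by simp) (ProbabilityTheory.memLp_id_gaussianReal' q hqtop).2.ne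
  have hKr : K = ENNReal.ofReal K.toReal := (ENNReal.ofReal_toReal hKtop).symm
  set κ := K.toReal with hκ
  have hκ0 : 0 ≤ κ := ENNReal.toReal_nonneg
  have hWm : ∀ u, Measurable (W u) := fun u => (hW.adapted u).mono (F.le u) le_rfl
  have hTr : 0 < T - r := by linarith
  refine ⟨(T - r) * ((T - r) * ((cp ^ (1 / p)) ^ 2 * (cT * κ) ^ 2)) + 1, by positivity, fun n => ?_⟩
  set m := pmesh k t n with hmdef
  have hle : ∀ i < k n, t n (i + 1) - t n i ≤ m := fun i hi =>
    le_csSup ((Set.finite_Iio (k n)).image _).bddAbove ⟨i, hi, rfl⟩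
  have hm0 : 0 < m := by
    have := hle 0 (hk n)
    have := hmono n 0 (hk n)
    linarith
  let c : ℕ → Ω → EuclideanSpace ℝ (Fin d) := fun i ω =>
    if i = 0 then 0 else ((t n (i + 1) - t n i)⁻¹) • (W (t n i) ω - W (t n (i - 1)) ω)
  have hcm : ∀ i, Measurable (c i) := by
    intro i
    by_cases hi : i = 0
    · simp only [c, hi, if_true]; exact measurable_const
    · simp only [c, hi, if_false]
      exact ((hWm _).sub (hWm _)).const_smul (_ : ℝ)
  let V : ℝ → Ω → EuclideanSpace ℝ (Fin d) := fun s ω =>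
    ∑ i ∈ Finset.range (k n), (Ioo (t n i) (t n (i + 1))).indicator (fun _ => c i ω) s
  have hVm : Measurable fun z : ℝ × Ω => V z.1 z.2 := by
    refine Finset.measurable_sum _ fun i _ => ?_
    exact ((hcm i).comp measurable_snd).indicator (measurable_fst measurableSet_Ioo)
  have hVeq : ∀ i < k n, ∀ s ∈ Ioo (t n i) (t n (i + 1)), ∀ ω, V s ω = c i ω := by
    intro i hi s hs ω
    simp only [V]
    rw [Finset.sum_eq_single i]
    · exact indicator_of_mem hs _
    · intro j hj hne
      refine indicator_of_notMem (fun hsj => hne ?_) _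
      exact part_unique (k n) (t n) (hmono n) j i (Finset.mem_range.1 hj) hi s hsj hs
    · intro h
      exact absurd (Finset.mem_range.2 hi) h
  have hae : ∀ᵐ s ∂(volume.restrict (Icc r T)),
      s ∈ Ico r T ∧ ∃ i < k n, s ∈ Ioo (t n i) (t n (i + 1)) := by
    have h1 : ∀ᵐ s ∂(volume.restrict (Icc r T)), s ∉ range (t n) :=
      ae_restrict_of_ae ((countable_range (t n)).ae_notMem volume)
    filter_upwards [h1, ae_restrict_mem measurableSet_Icc] with s hs hsI
    have hne : ∀ i, s ≠ t n i := fun i h => hs ⟨i, h.symm⟩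
    have hl : t n 0 < s := lt_of_le_of_ne (by rw [ht0]; exact hsI.1) (hne 0).symm
    have hr' : s ≤ t n (k n) := by rw [htlast]; exact hsI.2
    obtain ⟨i, hi, h2, h3⟩ := part_exists (k n) (t n) s hl hr'
    refine ⟨⟨hsI.1, ?_⟩, i, hi, h2, lt_of_le_of_ne h3 (hne _)⟩
    have := lt_of_le_of_ne hr' (hne _)
    rwa [htlast] at this
  have hcb : ∀ i < k n, eLpNorm (c i) q P ≤ ENNReal.ofReal (cT / m * (κ * Real.sqrt m)) := by
    intro i hi
    by_cases hi0 : i = 0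
    · have : c i = 0 := by ext1 ω; simp [c, hi0]
      rw [this]; simp
    · have hc : c i = ((t n (i + 1) - t n i)⁻¹) •
          (fun ω => W (t n i) ω - W (t n (i - 1)) ω) := by
        ext1 ω; simp [c, hi0]
      have hΔ : 0 < t n (i + 1) - t n i := sub_pos.2 (hmono n i hi)
      have e : i - 1 + 1 = i := by omega
      have h1 := hle (i - 1) (by omega)
      have h2 := hmono n (i - 1) (by omega)
      rw [e] at h1 h2
      have h3 : 0 ≤ t n (i - 1) := by
        have := part_mono (k n) (t n) (hmono n) 0 (i - 1) (by omega) (by omega)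
        rw [ht0] at this; linarith
      have h4 : t n i ≤ T := by
        have := part_mono (k n) (t n) (hmono n) i (k n) (by omega) le_rfl
        rwa [htlast] at this
      have hmom' := incr_moment P F W hW q hq1 (t n (i - 1)) (t n i) h3 h2.le h4
      rw [hc, eLpNorm_const_smul, Real.enorm_eq_ofReal (inv_nonneg.2 hΔ.le)]
      have h5 : (t n (i + 1) - t n i)⁻¹ ≤ cT / m := by
        rw [inv_le_comm₀ hΔ (by positivity), inv_div, div_le_iff₀ (by linarith), mul_comm]
        exact hbal n i hi
      rw [ENNReal.ofReal_mul (by positivity), ENNReal.ofReal_mul hκ0, ← hKr]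
      refine mul_le_mul' (ENNReal.ofReal_le_ofReal h5) (hmom'.trans ?_)
      exact mul_le_mul' le_rfl (ENNReal.ofReal_le_ofReal (Real.sqrt_le_sqrt h1))
  have hXb : ∀ s ∈ Ico r T, eLpNorm (X n s) pe P ≤ ENNReal.ofReal (cp ^ (1 / p) * m) := by
    intro s hs
    rw [eLpNorm_eq_lintegral_rpow_enorm_toReal (by simp [hpe, hP0]) (by simp [hpe]), hpe,
      ENNReal.toReal_ofReal hP0.le]
    have h1 : ∫⁻ ω, ‖X n s ω‖ₑ ^ p ∂P ≤ ENNReal.ofReal (cp * m ^ p) := by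
      simp_rw [Real.enorm_eq_ofReal (hXpos n s _)]
      exact hmom n s hs
    refine (ENNReal.rpow_le_rpow h1 (by positivity)).trans (le_of_eq ?_)
    rw [ENNReal.ofReal_rpow_of_nonneg (by positivity) (by positivity),
      Real.mul_rpow hcp.le (by positivity), ← Real.rpow_mul hm0.le, mul_one_div_cancel hP0.ne',
      Real.rpow_one]
  have key := integral_bound r T hrT P (X n) (hXmeas n) (W' n) V hVm (hae.mono ?_)
    (ENNReal.ofReal (cp ^ (1 / p) * m) * ENNReal.ofReal (cT / m * (κ * Real.sqrt m)))
    (hae.mono ?_)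
  · refine key.trans ?_
    rw [← ENNReal.ofReal_mul (by positivity), ← ENNReal.ofReal_pow (by positivity),
      ← ENNReal.ofReal_mul hTr.le, ← ENNReal.ofReal_mul hTr.le]
    refine ENNReal.ofReal_le_ofReal ?_
    have e : (cp ^ (1 / p) * m * (cT / m * (κ * Real.sqrt m))) ^ 2
        = (cp ^ (1 / p)) ^ 2 * (cT * κ) ^ 2 * m := by
      have h1 : cp ^ (1 / p) * m * (cT / m * (κ * Real.sqrt m))
          = cp ^ (1 / p) * (cT * κ) * Real.sqrt m := by
        field_simp
      rw [h1, mul_pow, Real.sq_sqrt hm0.le]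
      ring
    rw [e]
    nlinarith [hm0]
  · rintro s ⟨-, i, hi, hs⟩ ω
    rw [hVeq i hi s hs ω]
    by_cases hi0 : i = 0
    · subst hi0
      simp only [c, if_true]
      exact (hW' n ω).1 s (by simpa [ht0] using hs)
    · simp only [c, hi0, if_false]
      exact (hW' n ω).2 i (by omega) hi s hs
  · rintro s ⟨hsI, i, hi, hs⟩
    have hXs : Measurable (X n s) := (hXmeas n).comp measurable_prodMk_left
    have hVs : V s = c i := funext fun ω => hVeq i hi s hs ω
    refine (eLpNorm_smul_le_mul_eLpNorm (p := pe) (q := q)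
      (by rw [hVs]; exact (hcm i).norm.aestronglyMeasurable)
      hXs.aestronglyMeasurable).trans ?_
    refine mul_le_mul' (hXb s hsI) ?_
    rw [eLpNorm_norm, hVs]
    exact hcb i hi
end
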